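/- Let (s_k) and (t_k) be sequences of positive integers with s_i = t_i for all 1 ≤ i < I and s_I < t_I, and suppose I is even. Write α = α_I^{(s)} (which equals α_I^{(t)} since the two sequences agree before index I). Then the word [1] ++ α^{s_I} ++ [1] does not belong to L^{(t)}, and the word [0] ++ ᾱ^{s_I} ++ [0] does not belong to L^{(t)}. -/

import Mathlib

/-- The complement of a binary word: negate every letter. -/
def wordCompl (w : List Bool) : List Bool := w.map Bool.not

/-- `wordPow u k` is the concatenation of `k` copies of `u`. -/
def wordPow (u : List Bool) (k : ℕ) : List Bool := (List.replicate k u).flatten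

/-- Pouzet's words `α_i^{(s)}`: `α_1 = [0,1]`, `α_{i+1} = α_i^{s_i} ++ ᾱ_i^{s_i}`. -/
def alphaWord (s : ℕ → ℕ) : ℕ → List Bool
  | 0 => []
  | 1 => [false, true]
  | (i + 2) => wordPow (alphaWord s (i + 1)) (s (i + 1)) ++
      wordPow (wordCompl (alphaWord s (i + 1))) (s (i + 1))

/-- The language `L^{(s)}` of all factors of the words `α_i^{(s)}`, `i ≥ 1`. -/
def langL (s : ℕ → ℕ) : Set (List Bool) :=
  {w | ∃ i, 1 ≤ i ∧ w <:+: alphaWord s i}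

/-- The morphism `b ↦ b^a (!b)^a`. -/
def sg (a : ℕ) (w : List Bool) : List Bool :=
  w.flatMap (fun b => List.replicate a b ++ List.replicate a (!b))

/-- Composition of the morphisms. -/
def Psi (t : ℕ → ℕ) : ℕ → List Bool → List Bool
  | 0, w => w
  | (i + 1), w => Psi t i (sg (if i = 0 then 1 else t i) w)

/-- Occurrence of `u` in `w` at position `n`. -/
def Occ (u w : List Bool) (n : ℕ) : Prop :=
  ∀ i b, u[i]? = some b → w[n + i]? = some b

theorem sg_append (a : ℕ) (u v : List Bool) : sg a (u ++ v) = sg a u ++ sg a v := by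
  simp [sg]

theorem sg_compl (a : ℕ) (u : List Bool) : sg a (wordCompl u) = wordCompl (sg a u) := by
  induction u with
  | nil => rfl
  | cons b u ih =>
    simp only [sg, wordCompl, List.map_cons, List.flatMap_cons, List.map_append] at *
    rw [ih]; simp

theorem sg_length (a : ℕ) (u : List Bool) : (sg a u).length = 2 * a * u.length := by
  induction u with
  | nil => rfl
  | cons b u ih =>
    simp only [sg, List.flatMap_cons, List.length_append, List.length_replicate,
      List.length_cons] at *
    rw [ih]; ring

theorem sg_get (a : ℕ) (w : List Bool) (q r : ℕ) (hr : r < 2 * a) :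
    (sg a w)[2 * a * q + r]? = w[q]?.map (if a ≤ r then Bool.not else id) := by
  induction w generalizing q with
  | nil => simp [sg]
  | cons b w ih =>
    have e : sg a (b :: w) = (List.replicate a b ++ List.replicate a (!b)) ++ sg a w := by
      simp [sg]
    rw [e]
    cases q with
    | zero =>
      rw [List.getElem?_append_left (by simp; omega)]
      by_cases h : a ≤ r
      · rw [List.getElem?_append_right (by simp; omega)]
        simp [h, List.getElem?_replicate]
        try omega
      · rw [List.getElem?_append_left (by simp; omega)]
        simp [h, List.getElem?_replicate]
        try omega
    | succ q =>
      rw [List.getElem?_append_right (by simp; nlinarith)]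
      have : 2 * a * (q + 1) + r - (List.replicate a b ++ List.replicate a (!b)).length
          = 2 * a * q + r := by
        simp only [List.length_append, List.length_replicate]
        have : 2 * a * (q+1) = 2 * a * q + 2 * a := by ring
        omega
      rw [this, ih]; simp

/-- two positions in the same half-block carry equal letters, in opposite halves different. -/
theorem sg_two (a : ℕ) (w : List Bool) (q r r' : ℕ) (hr : r < 2 * a) (hr' : r' < 2 * a)
    (b b' : Bool) (i i' : ℕ) (hi : i = 2 * a * q + r) (hi' : i' = 2 * a * q + r')
    (h : (sg a w)[i]? = some b) (h' : (sg a w)[i']? = some b') :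
    b = b' ↔ (a ≤ r ↔ a ≤ r') := by
  subst hi hi'
  rw [sg_get a w q r hr] at h
  rw [sg_get a w q r' hr'] at h'
  cases hw : w[q]? with
  | none => simp [hw] at h
  | some c =>
    simp only [hw, Option.map_some, Option.some.injEq] at h h'
    subst h h'
    by_cases h1 : a ≤ r <;> by_cases h2 : a ≤ r' <;> simp [h1, h2]

theorem pad_get_mid (x y : Bool) (u : List Bool) (i : ℕ) (b : Bool) (h : u[i]? = some b) :
    ([x] ++ u ++ [y])[i + 1]? = some b := by
  have hl : i < u.length := by
    by_contra hc
    rw [List.getElem?_eq_none (by omega)] at h; simp at h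
  rw [List.getElem?_append_left (by simp; omega)]
  simpa using h

theorem occ_mid {x y : Bool} {u w : List Bool} {n : ℕ} (h : Occ ([x] ++ u ++ [y]) w n)
    (i : ℕ) (b : Bool) (hb : u[i]? = some b) : w[n + 1 + i]? = some b := by
  have := h (i + 1) b (pad_get_mid x y u i b hb)
  rwa [show n + (i + 1) = n + 1 + i by ring] at this

theorem occ_first {x y : Bool} {u w : List Bool} {n : ℕ} (h : Occ ([x] ++ u ++ [y]) w n) :
    w[n]? = some x := h 0 x (by simp)

theorem occ_last {x y : Bool} {u w : List Bool} {n : ℕ} (h : Occ ([x] ++ u ++ [y]) w n) :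
    w[n + 1 + u.length]? = some y := by
  have := h (u.length + 1) y (by
    rw [List.getElem?_append_right (by simp)]; simp)
  rwa [show n + (u.length + 1) = n + 1 + u.length by ring] at this

theorem occ_mk {x y : Bool} {u w : List Bool} {n : ℕ} (h1 : w[n]? = some x)
    (h2 : ∀ i b, u[i]? = some b → w[n + 1 + i]? = some b)
    (h3 : w[n + 1 + u.length]? = some y) : Occ ([x] ++ u ++ [y]) w n := by
  intro i b hb
  cases i with
  | zero => simp at hb; subst hb; exact h1
  | succ i =>
    rw [show n + (i + 1) = n + 1 + i by ring]
    rcases lt_trichotomy i u.length with h | h | h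
    · apply h2
      rw [List.getElem?_append_left (by simp; omega)] at hb
      simpa using hb
    · subst h
      rw [List.getElem?_append_right (by simp)] at hb
      simp at hb; subst hb; exact h3
    · rw [List.getElem?_eq_none (by simp; omega)] at hb; simp at hb

theorem align (a : ℕ) (ha : 0 < a) (x y : Bool) (v w : List Bool) (n Q : ℕ)
    (h : Occ ([x] ++ sg a v ++ [y]) (sg a w) n) (hn : n + 1 = 2 * a * Q) :
    ∃ n', Occ ([!x] ++ v ++ [y]) w n' := by
  obtain ⟨P, rfl⟩ : ∃ P, Q = P + 1 := by
    cases Q with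
    | zero => simp at hn
    | succ P => exact ⟨P, rfl⟩
  refine ⟨P, occ_mk ?_ ?_ ?_⟩
  · have h1 := occ_first h
    have e : n = 2 * a * P + (2 * a - 1) := by
      have : 2 * a * (P+1) = 2 * a * P + 2 * a := by ring
      omega
    rw [e, sg_get a w P _ (by omega), if_pos (by omega)] at h1
    cases hw : w[P]? with
    | none => simp [hw] at h1
    | some c => simp [hw] at h1; simp [← h1]
  · intro i b hb
    have h1 := occ_mid h (2 * a * i + 0) b (by
      rw [sg_get a v i 0 (by omega), hb, if_neg (by omega)]; rfl)
    rw [hn, show 2 * a * (P + 1) + (2 * a * i + 0) = 2 * a * (P + 1 + i) + 0 by ring,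
      sg_get a w _ 0 (by omega), if_neg (by omega)] at h1
    simpa using h1
  · have h1 := occ_last h
    rw [hn, sg_length, show 2 * a * (P + 1) + 2 * a * v.length
      = 2 * a * (P + 1 + v.length) + 0 by ring,
      sg_get a w _ 0 (by omega), if_neg (by omega)] at h1
    simpa using h1

theorem divmod (a m : ℕ) (ha : 0 < a) : ∃ q r, m = 2 * a * q + r ∧ r < 2 * a :=
  ⟨m / (2 * a), m % (2 * a), (Nat.div_add_mod _ _).symm, Nat.mod_lt _ (by omega)⟩

theorem stepB (a : ℕ) (ha : 0 < a) (v w : List Bool) (n : ℕ) (hv : v[0]? = some false)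
    (h : Occ ([false] ++ sg a v ++ [true]) (sg a w) n) :
    ∃ n', Occ ([true] ++ v ++ [true]) w n' := by
  obtain ⟨q, r, hq, hr⟩ := divmod a (n + 1) ha
  have hlet : ∀ j, j < 2 * a → (sg a w)[n + 1 + j]? = some (decide (a ≤ j)) := by
    intro j hj
    apply occ_mid h
    have := sg_get a v 0 j hj
    rw [hv] at this
    simp only [mul_zero, zero_add] at this
    rw [this]
    by_cases hh : a ≤ j <;> simp [hh]
  have hf := occ_first h
  by_cases h0 : r = 0
  · exact align a ha false true v w n q h (by omega)
  exfalso
  have e1 : 2 * a * (q + 1) = 2 * a * q + 2 * a := by ring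
  rcases lt_trichotomy r a with hra | hra | hra
  · have := sg_two a w q (r - 1) a (by omega) (by omega) _ _ n (n + 1 + (a - r))
      (by omega) (by omega) hf (hlet (a - r) (by omega))
    simp at this; omega
  · have := sg_two a w q (r - 1) r (by omega) (by omega) _ _ n (n + 1 + 0)
      (by omega) (by omega) hf (hlet 0 (by omega))
    simp at this; omega
  · have := sg_two a w (q + 1) (r - a) (r - 1) (by omega) (by omega) _ _ (n + 1 + a)
      (n + 1 + (2 * a - 1)) (by omega) (by omega) (hlet a (by omega)) (hlet _ (by omega))
    have h1 : a ≤ 2 * a - 1 := by omega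
    simp [h1] at this; omega

theorem stepA (a b : ℕ) (ha : 0 < a) (hb : 0 < b) (v w : List Bool) (n : ℕ)
    (hv : v[0]? = some false)
    (h : Occ ([true] ++ sg a (sg b v) ++ [true]) (sg a w) n) :
    ∃ n', Occ ([false] ++ sg b v ++ [true]) w n' := by
  have hv1 : (sg b v)[b - 1]? = some false := by
    have := sg_get b v 0 (b - 1) (by omega)
    rw [hv, if_neg (by omega)] at this
    simpa using this
  have hv2 : (sg b v)[b]? = some true := by
    have := sg_get b v 0 b (by omega)
    rw [hv] at this
    simpa using this
  have eb : 2 * a * b = 2 * a * (b - 1) + 2 * a := by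
    obtain ⟨c, rfl⟩ : ∃ c, b = c + 1 := ⟨b - 1, by omega⟩
    simp; ring
  have hlet : ∀ j, j < 2 * a → (sg a w)[n + 1 + 2 * a * (b - 1) + a + j]? = some true := by
    intro j hj
    by_cases hja : j < a
    · have := sg_get a (sg b v) (b - 1) (a + j) (by omega)
      rw [hv1, if_pos (by omega)] at this
      have := occ_mid h _ true this
      rw [← this]; congr 1; ring
    · have := sg_get a (sg b v) b (j - a) (by omega)
      rw [hv2, if_neg (by omega)] at this
      have := occ_mid h _ true this
      rw [← this]; congr 1; omega
  obtain ⟨q, r, hq, hr⟩ := divmod a (n + 1 + 2 * a * (b - 1) + a) ha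
  have e1 : 2 * a * (q + 1) = 2 * a * q + 2 * a := by ring
  rcases lt_trichotomy r a with hra | hra | hra
  · exfalso
    have := sg_two a w q r a (by omega) (by omega) _ _ _ _
      (by omega) (by omega) (hlet 0 (by omega)) (hlet (a - r) (by omega))
    simp at this; omega
  · have e2 : n + 1 = 2 * a * (q - (b - 1)) := by
      rw [Nat.mul_sub]; omega
    exact align a ha true true (sg b v) w n _ h e2
  · exfalso
    have := sg_two a w (q + 1) 0 a (by omega) (by omega) _ _ _ _
      (by omega) (by omega) (hlet (2 * a - r) (by omega)) (hlet (3 * a - r) (by omega))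
    simp at this; omega

theorem final (t k : ℕ) (hk : 0 < k) (hkt : k < t) (w : List Bool) (n : ℕ)
    (h : Occ ([true] ++ List.replicate k false ++ [true]) (sg t w) n) : False := by
  have hf := occ_first h
  have hl := occ_last h
  have hm := occ_mid h 0 false (by simp [List.getElem?_replicate, hk])
  simp only [List.length_replicate] at hl
  obtain ⟨q, r, hq, hr⟩ := divmod t (n + 1) (by omega)
  by_cases hc : r = 0 ∨ r = t
  · have := sg_two t w q r (r + k) (by omega) (by omega) _ _ _ _
      (by omega) (by omega) hm hl
    simp at this; omega
  · have := sg_two t w q r (r - 1) (by omega) (by omega) _ _ _ n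
      (by omega) (by omega) hm hf
    simp at this; omega

theorem sg_head (a : ℕ) (ha : 0 < a) (v : List Bool) (hv : v[0]? = some false) :
    (sg a v)[0]? = some false := by
  have := sg_get a v 0 0 (by omega)
  rw [hv, if_neg (by omega)] at this
  simpa using this

theorem Psi_desub (t : ℕ → ℕ) (ht : ∀ k, 0 < t k) (m : ℕ) : ∀ (v w : List Bool) (n : ℕ),
    v[0]? = some false →
    Occ ([true] ++ Psi t (2 * m) v ++ [true]) (Psi t (2 * m) w) n →
    ∃ n', Occ ([true] ++ v ++ [true]) w n' := by
  induction m with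
  | zero => intro v w n _ h; exact ⟨n, h⟩
  | succ m ih =>
    intro v w n hv h
    have p : ∀ i, 0 < (if i = 0 then 1 else t i) := by
      intro i; split_ifs; exact one_pos; exact ht i
    rw [show 2 * (m + 1) = 2 * m + 1 + 1 by ring] at h
    simp only [Psi] at h
    obtain ⟨n1, h1⟩ := ih _ _ n (sg_head _ (p _) _ (sg_head _ (p (2 * m + 1)) _ hv)) h
    obtain ⟨n2, h2⟩ := stepA _ _ (p _) (p (2 * m + 1)) v _ n1 hv h1
    exact stepB _ (p (2 * m + 1)) v w n2 hv h2

theorem Psi_append (t : ℕ → ℕ) (i : ℕ) : ∀ u v, Psi t i (u ++ v) = Psi t i u ++ Psi t i v := by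
  induction i with
  | zero => intro u v; rfl
  | succ i ih => intro u v; simp only [Psi, sg_append, ih]

theorem Psi_nil (t : ℕ → ℕ) (i : ℕ) : Psi t i [] = [] := by
  induction i with
  | zero => rfl
  | succ i ih => simpa [Psi, sg] using ih

theorem Psi_compl (t : ℕ → ℕ) (i : ℕ) : ∀ u, Psi t i (wordCompl u) = wordCompl (Psi t i u) := by
  induction i with
  | zero => intro u; rfl
  | succ i ih => intro u; simp only [Psi, sg_compl, ih]

theorem Psi_pow (t : ℕ → ℕ) (i k : ℕ) (b : Bool) :
    Psi t i (List.replicate k b) = wordPow (Psi t i [b]) k := by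
  induction k with
  | zero => simp [wordPow, Psi_nil]
  | succ k ih =>
    rw [List.replicate_succ, show b :: List.replicate k b = [b] ++ List.replicate k b from rfl,
      Psi_append, ih]
    simp [wordPow, List.replicate_succ]

theorem alpha_eq (t : ℕ → ℕ) (i : ℕ) : alphaWord t (i + 1) = Psi t (i + 1) [false] := by
  induction i with
  | zero => rfl
  | succ i ih =>
    rw [alphaWord, ih, ← Psi_compl]
    have : Psi t (i + 1 + 1) [false] =
      Psi t (i + 1) (List.replicate (t (i+1)) false ++ List.replicate (t (i+1)) true) := by
      rw [Psi]; simp [sg]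
    rw [this, Psi_append, Psi_pow, Psi_pow]; rfl

theorem Psi_factor (t : ℕ → ℕ) (I d : ℕ) : ∀ v, ∃ w, Psi t (I + d) v = Psi t I w := by
  induction d with
  | zero => intro v; exact ⟨v, rfl⟩
  | succ d ih => intro v; rw [← add_assoc, Psi]; exact ih _

theorem pow_infix (u : List Bool) (k : ℕ) (hk : 0 < k) : u <:+: wordPow u k := by
  obtain ⟨c, rfl⟩ : ∃ c, k = c + 1 := ⟨k - 1, by omega⟩
  simp only [wordPow, List.replicate_succ, List.flatten_cons]
  exact (List.prefix_append _ _).isInfix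

theorem alpha_succ (t : ℕ → ℕ) (ht : ∀ k, 0 < t k) (i : ℕ) :
    alphaWord t i <:+: alphaWord t (i + 1) := by
  cases i with
  | zero => exact List.nil_infix
  | succ i =>
    rw [alphaWord]
    exact (pow_infix _ _ (ht _)).trans (List.prefix_append _ _).isInfix

theorem alpha_mono (t : ℕ → ℕ) (ht : ∀ k, 0 < t k) (i d : ℕ) :
    alphaWord t i <:+: alphaWord t (i + d) := by
  induction d with
  | zero => exact List.infix_rfl
  | succ d ih => exact ih.trans (alpha_succ t ht _)

theorem compl_compl_word (u : List Bool) : wordCompl (wordCompl u) = u := by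
  have : (not ∘ not) = id := by funext b; simp
  simp [wordCompl, this]

theorem langL_compl (t : ℕ → ℕ) (ht : ∀ k, 0 < t k) (u : List Bool) (h : u ∈ langL t) :
    wordCompl u ∈ langL t := by
  obtain ⟨i, hi, h⟩ := h
  refine ⟨i + 1, by omega, ?_⟩
  obtain ⟨j, rfl⟩ : ∃ c, i = c + 1 := ⟨i - 1, by omega⟩
  have h2 : wordCompl u <:+: wordCompl (alphaWord t (j + 1)) := h.map _
  rw [alphaWord]
  exact h2.trans ((pow_infix _ _ (ht _)).trans (List.suffix_append _ _).isInfix)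

theorem compl_pow (u : List Bool) (k : ℕ) : wordCompl (wordPow u k) = wordPow (wordCompl u) k := by
  simp [wordCompl, wordPow, List.map_flatten]

theorem alpha_congr (s t : ℕ → ℕ) (I : ℕ) (hagree : ∀ i, 1 ≤ i → i < I → s i = t i) :
    ∀ i, i ≤ I → alphaWord s i = alphaWord t i := by
  intro i
  induction i with
  | zero => intro _; rfl
  | succ i ih =>
    intro hi
    cases i with
    | zero => rfl
    | succ i =>
      rw [alphaWord, alphaWord, ih (by omega), hagree (i + 1) (by omega) (by omega)]

theorem first_part (t : ℕ → ℕ) (ht : ∀ k, 0 < t k) (I k : ℕ) (hI : 1 ≤ I) (hIeven : Even I)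
    (hk : 0 < k) (hlt : k < t I) :
    ([true] ++ wordPow (alphaWord t I) k ++ [true]) ∉ langL t := by
  rintro ⟨i, hi, h⟩
  have h := h.trans (alpha_mono t ht i (I + 1))
  rw [show i + (I + 1) = (I + i) + 1 by ring, alpha_eq,
    show I + i + 1 = (I + 1) + i by ring] at h
  obtain ⟨w, hw⟩ := Psi_factor t (I + 1) i [false]
  obtain ⟨j, hj⟩ : ∃ c, I = c + 1 := ⟨I - 1, by omega⟩
  have hα : alphaWord t I = Psi t I [false] := by rw [hj, alpha_eq]
  rw [hw, hα, ← Psi_pow, Psi, if_neg (by omega)] at h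
  obtain ⟨m, hm⟩ := hIeven
  have hm : I = 2 * m := by omega
  obtain ⟨p, q, hpq⟩ := h
  have hocc : Occ ([true] ++ Psi t I (List.replicate k false) ++ [true])
      (Psi t I (sg (t I) w)) p.length := by
    intro i b hb
    rw [← hpq, List.append_assoc p, List.getElem?_append_right (by omega),
      Nat.add_sub_cancel_left]
    rw [List.getElem?_append_left]
    · exact hb
    · by_contra hc
      rw [List.getElem?_eq_none (by omega)] at hb
      simp at hb
  have hocc2 := hocc
  generalize sg (t I) w = W at hocc2
  have key : ∀ W n, Occ ([true] ++ Psi t I (List.replicate k false) ++ [true]) (Psi t I W) n →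
      ∃ n', Occ ([true] ++ List.replicate k false ++ [true]) W n' := by
    rw [hm]
    intro W n
    exact Psi_desub t ht m _ W n (by simp [List.getElem?_replicate, hk])
  obtain ⟨n', hn'⟩ := key _ _ hocc
  exact final (t I) k hk hlt w n' hn'

theorem padded_powers_not_in_langL_t (s t : ℕ → ℕ) (hs : ∀ k, 0 < s k) (ht : ∀ k, 0 < t k)
    (I : ℕ) (hI : 1 ≤ I) (hIeven : Even I)
    (hagree : ∀ i, 1 ≤ i → i < I → s i = t i) (hlt : s I < t I) :
    ([true] ++ wordPow (alphaWord s I) (s I) ++ [true]) ∉ langL t ∧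
    ([false] ++ wordPow (wordCompl (alphaWord s I)) (s I) ++ [false]) ∉ langL t := by
  rw [alpha_congr s t I hagree I le_rfl]
  have h1 := first_part t ht I (s I) hI hIeven (hs I) hlt
  refine ⟨h1, fun h2 => h1 ?_⟩
  have h3 := langL_compl t ht _ h2
  have e : wordCompl ([false] ++ wordPow (wordCompl (alphaWord t I)) (s I) ++ [false])
      = [true] ++ wordPow (alphaWord t I) (s I) ++ [true] := by
    rw [← compl_pow]
    have : (not ∘ not) = id := by funext b; simp
    simp [wordCompl, this]
  rwa [e] at h3
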